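/- Let M be a minimally vertically 4-connected matroid with a triangle T. Then (1) M has a 4-element cocircuit that contains exactly two elements of T, or (2) M has a 5-element cocircuit that contains a triangle and exactly two elements of T, or (3) |E(M)| ≤ 11. -/

import Mathlib

open Set Matroid

universe u

variable {α : Type u}

/-- The rank of a set `X` in a matroid `M`: the supremum of the cardinalities of the
independent subsets of `X`. -/
noncomputable def mrk (M : Matroid α) (X : Set α) : ℕ∞ :=
  ⨆ I ∈ {I : Set α | M.Indep I ∧ I ⊆ X}, I.encard

/-- The rank `r(M)` of a matroid `M`. -/
noncomputable def mrank (M : Matroid α) : ℕ∞ := mrk M M.E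

/-- The connectivity function `λ_M(X) = r(X) + r(E(M) - X) - r(M)`. -/
noncomputable def lam (M : Matroid α) (X : Set α) : ℕ∞ :=
  mrk M X + mrk M (M.E \ X) - mrank M

/-- The deletion `M \ D` of a set of elements `D` from `M`. -/
def mdel (M : Matroid α) (D : Set α) : Matroid α := M ↾ (M.E \ D)

/-- A circuit of a matroid: a minimal dependent set. -/
def MCircuit (M : Matroid α) (C : Set α) : Prop := M.Dep C ∧ ∀ D, D ⊂ C → M.Indep D

/-- A cocircuit of a matroid: a circuit of the dual matroid. -/
def MCocircuit (M : Matroid α) (C : Set α) : Prop := MCircuit M✶ C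

/-- A triangle: a 3-element circuit. -/
def IsTriangle (M : Matroid α) (T : Set α) : Prop := MCircuit M T ∧ T.encard = 3

/-- `(X, Y)` is a vertical `j`-separation of `M`: a partition of `E(M)` with
`λ_M(X) < j` and `min {r(X), r(Y)} ≥ j`. -/
def IsVSep (M : Matroid α) (j : ℕ) (X Y : Set α) : Prop :=
  X ∪ Y = M.E ∧ Disjoint X Y ∧ lam M X < (j : ℕ∞) ∧
    (j : ℕ∞) ≤ mrk M X ∧ (j : ℕ∞) ≤ mrk M Y

/-- An exact vertical `j`-separation: one with `λ_M(X) = j - 1`. -/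
def IsExactVSep (M : Matroid α) (j : ℕ) (X Y : Set α) : Prop :=
  IsVSep M j X Y ∧ lam M X = (j : ℕ∞) - 1

/-- `M` is vertically `k`-connected: it has no vertical `j`-separation for a
positive integer `j < k`. -/
def VertConn (M : Matroid α) (k : ℕ) : Prop :=
  ∀ j X Y, 0 < j → j < k → ¬ IsVSep M j X Y

/-- `(X, Y)` is a (Tutte) `j`-separation of `M`. -/
def IsSep (M : Matroid α) (j : ℕ) (X Y : Set α) : Prop :=
  X ∪ Y = M.E ∧ Disjoint X Y ∧ lam M X < (j : ℕ∞) ∧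
    (j : ℕ∞) ≤ X.encard ∧ (j : ℕ∞) ≤ Y.encard

/-- `M` is (Tutte) `k`-connected. -/
def TConn (M : Matroid α) (k : ℕ) : Prop :=
  ∀ j X Y, 0 < j → j < k → ¬ IsSep M j X Y

/-- `M` is minimally vertically 4-connected. -/
def MinVertConn4 (M : Matroid α) : Prop :=
  VertConn M 4 ∧ ∀ e ∈ M.E, ¬ VertConn (mdel M {e}) 4

/-- `M` is a simple matroid: every subset of the ground set with at most two
elements is independent (no loops and no parallel pairs). -/
def MSimple (M : Matroid α) : Prop := ∀ S ⊆ M.E, S.encard ≤ 2 → M.Indep S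

/-- `M` has a restriction isomorphic to `U_{2,4}`: a 4-element subset of the ground set
of rank 2, all of whose subsets with at most 2 elements are independent. -/
def HasU24Restriction (M : Matroid α) : Prop :=
  ∃ X ⊆ M.E, X.encard = 4 ∧ mrk M X = 2 ∧ ∀ S ⊆ X, S.encard ≤ 2 → M.Indep S

/-- The restriction `M|X` is isomorphic to `U_{2,4}`. -/
def RestrIsoU24 (M : Matroid α) (X : Set α) : Prop :=
  X ⊆ M.E ∧ X.encard = 4 ∧ mrk M X = 2 ∧ ∀ S ⊆ X, S.encard ≤ 2 → M.Indep S

/-- The restriction `M|C` is isomorphic to `U_{2,k} ⊕ U_{2,2}`: `C` is the disjoint union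
of a `k`-element rank-2 set `L` containing no loops or parallel pairs (a copy of `U_{2,k}`)
and a 2-element independent set `P` (a copy of `U_{2,2}`), with `r(C) = r(L) + r(P) = 4`,
so that the restriction is the direct sum of the two pieces. -/
def RestrIsoLinePlusPair (M : Matroid α) (C : Set α) (k : ℕ) : Prop :=
  ∃ L P, C = L ∪ P ∧ Disjoint L P ∧ L.encard = (k : ℕ∞) ∧ P.encard = 2 ∧
    M.Indep P ∧ mrk M L = 2 ∧ (∀ S ⊆ L, S.encard ≤ 2 → M.Indep S) ∧ mrk M C = 4

/-- The restriction `M|X` is isomorphic to the 2-sum `U_{2,4} ⊕₂ U_{2,4}`: `X` is the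
disjoint union of two 3-element circuits `T₁` and `T₂`, and the circuits of `M` contained
in `X` (i.e. the circuits of `M|X`) are exactly `T₁`, `T₂`, and the unions `P₁ ∪ P₂` of
2-element subsets `P₁ ⊆ T₁` and `P₂ ⊆ T₂`. -/
def RestrIsoTwoSumU24U24 (M : Matroid α) (X : Set α) : Prop :=
  X ⊆ M.E ∧ ∃ T₁ T₂ : Set α, Disjoint T₁ T₂ ∧ X = T₁ ∪ T₂ ∧
    T₁.encard = 3 ∧ T₂.encard = 3 ∧
    ∀ C ⊆ X, (MCircuit M C ↔ (C = T₁ ∨ C = T₂ ∨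
      ∃ P₁ P₂, P₁ ⊆ T₁ ∧ P₂ ⊆ T₂ ∧ P₁.encard = 2 ∧ P₂.encard = 2 ∧ C = P₁ ∪ P₂))

/-- The columns of the `GF(3)`-matrix representing `N₉`. -/
def N9Cols : Fin 9 → Fin 4 → ZMod 3 :=
  ![![1, 0, 0, 0], ![0, 1, 0, 0], ![0, 0, 1, 0], ![0, 0, 0, 1], ![0, 1, 1, -1],
    ![1, 0, 1, 1], ![1, 1, 0, 1], ![-1, 1, 1, 0], ![1, -1, 1, -1]]

/-- `M` is isomorphic to `N₉`, the 9-element rank-4 matroid represented over `GF(3)`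
by the matrix with columns `N9Cols`. -/
def IsoN9 (M : Matroid α) : Prop :=
  ∃ φ : α → Fin 9, Set.BijOn φ M.E Set.univ ∧
    ∀ I ⊆ M.E, (M.Indep I ↔ LinearIndependent (ZMod 3) fun x : I => N9Cols (φ x.1))

/-- `M` is binary: representable over the two-element field `GF(2)`, i.e. there is a
map from the ground set to a `GF(2)`-vector space under which independence in `M`
coincides with linear independence. -/
def IsBinary (M : Matroid α) : Prop :=
  ∃ (ι : Type u) (φ : α → ι → ZMod 2),
    ∀ I ⊆ M.E, (M.Indep I ↔ LinearIndependent (ZMod 2) fun x : I => φ x.1)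

/-- `M` is a uniform matroid, i.e. isomorphic to `U_{m,n}` for some `m` and `n`:
the ground set has `n` elements and a subset of the ground set is independent
exactly when it has at most `m` elements. -/
def IsUniform (M : Matroid α) : Prop :=
  ∃ m n : ℕ, M.E.encard = (n : ℕ∞) ∧ ∀ I ⊆ M.E, (M.Indep I ↔ I.encard ≤ (m : ℕ∞))


structure VCtx (E : Set α) (ρ : Set α → ℕ) : Prop where
  mono : ∀ {X Y : Set α}, X ⊆ Y → ρ X ≤ ρ Y
  sub : ∀ X Y : Set α, ρ (X ∪ Y) + ρ (X ∩ Y) ≤ ρ X + ρ Y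
  unit : ∀ (e : α) (X : Set α), ρ (insert e X) ≤ ρ X + 1
  emp : ρ ∅ = 0
  pair : ∀ {x y : α}, x ∈ E → y ∈ E → x ≠ y → 2 ≤ ρ {x, y}
  sep : ∀ e ∈ E, ∃ X Y, X ∪ Y = E \ {e} ∧ Disjoint X Y ∧ ρ X < ρ (insert e X) ∧
    ρ Y < ρ (insert e Y) ∧ (4 ≤ ρ E → ρ X + ρ Y ≤ ρ E + 2 ∧ 3 ≤ ρ X ∧ 3 ≤ ρ Y)
  vc : 4 ≤ ρ E → ∀ X ⊆ E, 3 ≤ ρ X → 3 ≤ ρ (E \ X) → ρ E + 3 ≤ ρ X + ρ (E \ X)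
  vc2 : 4 ≤ ρ E → ∀ X ⊆ E, ρ X ≤ 2 → ρ (E \ X) = ρ E

namespace VCtx

variable {E : Set α} {ρ : Set α → ℕ}

/-- submodularity in inequality form -/
theorem sm (h : VCtx E ρ) {X Y P Q : Set α} (hP : P ⊆ X) (hP' : P ⊆ Y) (hQ : Q ⊆ X ∪ Y) :
    ρ Q + ρ P ≤ ρ X + ρ Y := by
  have h1 := h.sub X Y
  have h2 := h.mono hQ
  have h3 := h.mono (subset_inter hP hP')
  omega

theorem un (h : VCtx E ρ) {X Y Q : Set α} (hQ : Q ⊆ X ∪ Y) : ρ Q ≤ ρ X + ρ Y := by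
  have := h.sm (empty_subset X) (empty_subset Y) hQ
  have := h.emp
  omega

/-- closure monotonicity -/
theorem clo (h : VCtx E ρ) {X Y S Q : Set α} (hXY : X ⊆ Y) (hXS : X ⊆ S) (hS : ρ S ≤ ρ X)
    (hQ : Q ⊆ Y ∪ S) : ρ Q ≤ ρ Y := by
  have := h.sm hXY hXS hQ
  omega

theorem one_le (h : VCtx E ρ) {x y : α} (hx : x ∈ E) (hy : y ∈ E) (hxy : x ≠ y) : 1 ≤ ρ {x} := by
  have h1 := h.pair hy hx hxy.symm
  have h2 := h.unit y {x}
  omega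

theorem pairle (h : VCtx E ρ) {x y : α} {X : Set α} (hX : X ⊆ E) (hx : x ∈ X) (hy : y ∈ X)
    (hxy : x ≠ y) : 2 ≤ ρ X := by
  have h1 := h.pair (hX hx) (hX hy) hxy
  have h2 : ρ {x, y} ≤ ρ X := h.mono (by grind)
  omega

theorem subsing (h : VCtx E ρ) {X : Set α} (hX : X ⊆ E) (hr : ρ X ≤ 1) : X.Subsingleton := by
  intro x hx y hy
  by_contra hxy
  have := h.pairle hX hx hy hxy
  omega

theorem card1 (h : VCtx E ρ) {X : Set α} (hX : X ⊆ E) (hr : ρ X ≤ 1) :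
    X.Finite ∧ X.ncard ≤ 1 := by
  have := h.subsing hX hr
  exact ⟨this.finite, ncard_le_one_of_subsingleton_fix this⟩
where
  ncard_le_one_of_subsingleton_fix {X : Set α} (hs : X.Subsingleton) : X.ncard ≤ 1 := by
    rw [Set.ncard_le_one hs.finite]
    exact fun a ha b hb => hs ha hb

theorem rk_le_card (h : VCtx E ρ) {X : Set α} (hf : X.Finite) : ρ X ≤ X.ncard := by
  induction X, hf using Set.Finite.induction_on with
  | empty => simp [h.emp]
  | insert ha hs ih =>
    rename_i a s
    rw [Set.ncard_insert_of_notMem ha hs]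
    have := h.unit a s
    omega

/-- no four point lines -/
theorem line (h : VCtx E ρ) {L : Set α} (hL : L ⊆ E) (hr : ρ L ≤ 2) :
    L.Finite ∧ L.ncard ≤ 3 := by
  rcases L.eq_empty_or_nonempty with rfl | ⟨e, he⟩
  · simp
  obtain ⟨X, Y, hXY, hd, hX, hY, -⟩ := h.sep e (hL he)
  have key : ∀ Z, ρ Z < ρ (insert e Z) → (L ∩ Z).Subsingleton := by
    intro Z hZ x hx y hy
    by_contra hxy
    have h1 := h.pairle (X := {x, y}) (by grind) (x := x) (y := y) (by simp) (by simp) hxy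
    have h2 : ρ (insert e Z) ≤ ρ Z :=
      h.clo (X := {x, y}) (S := L) (by grind) (by grind) (by omega) (by grind)
    omega
  have hf : (insert e ((L ∩ X) ∪ (L ∩ Y))).Finite :=
    (((key X hX).finite).union ((key Y hY).finite)).insert e
  have hsub : L ⊆ insert e ((L ∩ X) ∪ (L ∩ Y)) := by
    intro x hx
    have : x ∈ E \ {e} ∨ x = e := by have := hL hx; grind
    rw [← hXY] at this
    grind
  refine ⟨hf.subset hsub, ?_⟩
  have h1 := Set.ncard_le_ncard hsub hf
  have h2 := Set.ncard_insert_le e ((L ∩ X) ∪ (L ∩ Y))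
  have h3 := Set.ncard_union_le (L ∩ X) (L ∩ Y)
  have h4 : (L ∩ X).ncard ≤ 1 := card1.ncard_le_one_of_subsingleton_fix (key X hX)
  have h5 : (L ∩ Y).ncard ≤ 1 := card1.ncard_le_one_of_subsingleton_fix (key Y hY)
  omega

/-- three points that contain a pair; rank at least two -/
theorem two_of_card (h : VCtx E ρ) {X : Set α} (hX : X ⊆ E) (hc : 2 ≤ X.ncard) : 2 ≤ ρ X := by
  by_contra hcon
  have := h.card1 hX (by omega)
  omega

theorem split (X Y E P : Set α) (e : α) (hXY : X ∪ Y = E \ {e}) (hd : Disjoint X Y)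
    (hP : P ⊆ E) (hfin : P.Finite) (heP : e ∉ P) : P.ncard = (P ∩ X).ncard + (P ∩ Y).ncard := by
  rw [← Set.ncard_union_eq (by rw [Set.disjoint_left] at *; grind) (hfin.inter_of_left _) (hfin.inter_of_left _)]
  congr 1
  ext x
  have : x ∈ X ∪ Y ↔ x ∈ E \ {e} := by rw [hXY]
  grind

theorem splite (X Y E P : Set α) (e : α) (hXY : X ∪ Y = E \ {e}) (hd : Disjoint X Y)
    (hP : P ⊆ E) (hfin : P.Finite) (heP : e ∈ P) : P.ncard = (P ∩ X).ncard + (P ∩ Y).ncard + 1 := by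
  have h1 := split X Y E (P \ {e}) e hXY hd (by grind) (hfin.sdiff) (by simp)
  have h2 := Set.ncard_sdiff_singleton_add_one heP hfin
  have hx : e ∉ X ∪ Y := by rw [hXY]; simp
  have h3 : P \ {e} ∩ X = P ∩ X := by ext x; grind
  have h4 : P \ {e} ∩ Y = P ∩ Y := by ext x; grind
  rw [h3, h4] at h1
  omega

theorem nonspan (h : VCtx E ρ) {P X : Set α} {e : α} {n : ℕ} (he : e ∈ P) (hP : ρ P ≤ n + 1)
    (hX : ρ X < ρ (insert e X)) : ρ (P ∩ X) ≤ n := by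
  by_contra hcon
  have h2 : ρ (insert e X) ≤ ρ X :=
    h.clo (X := P ∩ X) (S := P) (by grind) (by grind) (by omega) (by grind)
  omega

theorem two_lines_aux (h : VCtx E ρ) {S1 S2 X Y : Set α} {f : α} (h1 : S1 ⊆ E) (h2 : S2 ⊆ E)
    (hd : Disjoint S1 S2) (hr1 : ρ S1 ≤ 2) (hr2 : ρ S2 ≤ 2) (hc1 : S1.ncard = 3) (hc2 : S2.ncard = 3)
    (hr : ρ (S1 ∪ S2) ≤ 3) (hf : f ∈ S1) (hXY : X ∪ Y = E \ {f}) (hdXY : Disjoint X Y)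
    (hX : ρ X < ρ (insert f X)) (hY : ρ Y < ρ (insert f Y)) (h22 : 2 ≤ (S2 ∩ X).ncard) : False := by
  have e1 : ρ ((S1 ∪ S2) ∩ X) ≤ 2 := h.nonspan (Or.inl hf) (by omega) hX
  have e2 := h.two_of_card (X := S2 ∩ X) (by grind) h22
  have e3 : ρ (S2 ∪ ((S1 ∪ S2) ∩ X)) ≤ 2 := by
    have := h.sm (X := S2) (Y := (S1 ∪ S2) ∩ X) (P := S2 ∩ X) (Q := S2 ∪ ((S1 ∪ S2) ∩ X))
      (by grind) (by grind) (by grind)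
    omega
  have e4 := h.line (by grind) e3
  have e5 : S2 = S2 ∪ ((S1 ∪ S2) ∩ X) :=
    Set.eq_of_subset_of_ncard_le (by grind) (by omega) e4.1
  have hS1f : S1.Finite := Set.finite_of_ncard_ne_zero (by omega)
  have e6 : S1 \ {f} ⊆ Y := by
    intro x hx
    have hx' : x ∈ X ∪ Y := by rw [hXY]; grind
    rcases hx' with hx' | hx'
    · have : x ∈ S2 := by rw [e5]; grind
      exact absurd this (Set.disjoint_left.1 hd hx.1)
    · exact hx'
  have e7 := Set.ncard_sdiff_singleton_add_one hf hS1f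
  have e8 := h.two_of_card (X := S1 \ {f}) (by grind) (by omega)
  have : ρ (insert f Y) ≤ ρ Y := h.clo (X := S1 \ {f}) (S := S1) e6 (by grind) (by omega) (by grind)
  omega

theorem two_lines (h : VCtx E ρ) {S1 S2 : Set α} (h1 : S1 ⊆ E) (h2 : S2 ⊆ E)
    (hd : Disjoint S1 S2) (hr1 : ρ S1 ≤ 2) (hr2 : ρ S2 ≤ 2) (hc1 : S1.ncard = 3) (hc2 : S2.ncard = 3)
    (hr : ρ (S1 ∪ S2) ≤ 3) : False := by
  obtain ⟨f, hf⟩ : S1.Nonempty := Set.nonempty_of_ncard_ne_zero (by omega)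
  obtain ⟨X, Y, hXY, hdXY, hX, hY, -⟩ := h.sep f (h1 hf)
  have hs := split X Y E S2 f hXY hdXY h2 (Set.finite_of_ncard_ne_zero (by omega))
    (Set.disjoint_left.1 hd hf)
  by_cases hc : 2 ≤ (S2 ∩ X).ncard
  · exact h.two_lines_aux h1 h2 hd hr1 hr2 hc1 hc2 hr hf hXY hdXY hX hY hc
  · exact h.two_lines_aux h1 h2 hd hr1 hr2 hc1 hc2 hr hf (by rw [union_comm]; exact hXY) hdXY.symm hY hX
      (by omega)

theorem plane (h : VCtx E ρ) {P : Set α} (hP : P ⊆ E) (hr : ρ P ≤ 3) :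
    P.Finite ∧ P.ncard ≤ 6 := by
  rcases P.eq_empty_or_nonempty with rfl | ⟨e, he⟩
  · simp
  obtain ⟨X, Y, hXY, hd, hX, hY, -⟩ := h.sep e (hP he)
  have r1 : ρ (P ∩ X) ≤ 2 := h.nonspan he (by omega) hX
  have r2 : ρ (P ∩ Y) ≤ 2 := h.nonspan he (by omega) hY
  have l1 := h.line (by grind) r1
  have l2 := h.line (by grind) r2
  have hf : P.Finite := by
    refine ((l1.1.union l2.1).insert e).subset ?_
    intro x hx
    have : x ∈ E \ {e} ∨ x = e := by have := hP hx; grind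
    rw [← hXY] at this
    grind
  refine ⟨hf, ?_⟩
  have hs := splite X Y E P e hXY hd hP hf he
  by_contra hcon
  refine h.two_lines (S1 := P ∩ X) (S2 := P ∩ Y) (by grind) (by grind)
    (by rw [Set.disjoint_left] at *; grind) r1 r2 (by omega) (by omega) ?_
  exact (h.mono (by grind)).trans hr

theorem rank_four_aux (h : VCtx E ρ) (hE : ρ E ≤ 4) (hfin : E.Finite) {X Y : Set α} {e : α} (he : e ∈ E)
    (hXY : X ∪ Y = E \ {e}) (hd : Disjoint X Y) (rX : ρ X ≤ 3) (rY : ρ Y ≤ 3) (cX : X.ncard = 6)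
    (cY : 5 ≤ Y.ncard) : False := by
  have hXE : X ⊆ E := fun x hx => by have : x ∈ E \ {e} := hXY ▸ Or.inl hx; exact this.1
  have hYE : Y ⊆ E := fun x hx => by have : x ∈ E \ {e} := hXY ▸ Or.inr hx; exact this.1
  obtain ⟨f, hf⟩ : Y.Nonempty := Set.nonempty_of_ncard_ne_zero (by omega)
  have hfX : f ∉ X := Set.disjoint_right.1 hd hf
  obtain ⟨K, K', hK, hdK, hK1, hK2, -⟩ := h.sep f (hYE hf)
  have aux : ∀ K K', K ∪ K' = E \ {f} → Disjoint K K' → ρ K < ρ (insert f K) →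
      ρ K' < ρ (insert f K') → ρ (X ∩ K) ≤ 2 := by
    intro K K' hK hdK hK1 hK2
    have hKE : K ⊆ E := fun x hx => by have : x ∈ E \ {f} := hK ▸ Or.inl hx; exact this.1
    have rK : ρ K ≤ 3 := by
      have : ρ (insert f K) ≤ ρ E := h.mono (by have := hYE hf; grind)
      omega
    by_contra hcon
    have r1 : ρ (X ∪ K) ≤ 3 :=
      (h.clo (X := X ∩ K) (Y := K) (S := X) (by grind) (by grind) (by omega) (by grind)).trans rK
    have c1 := h.plane (by grind) r1
    have c2 : X = X ∪ K := Set.eq_of_subset_of_ncard_le (by grind) (by omega) c1.1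
    have r2 : ρ (Y ∩ K') ≤ 2 := h.nonspan hf (by omega) hK2
    have c3 := h.line (by grind) r2
    have c4 := splite K K' E Y f hK hdK hYE (hfin.subset hYE) hf
    have c5 : Y ∩ K = ∅ := by
      ext x
      have : x ∈ K → x ∈ X := fun hx => by rw [c2]; exact Or.inr hx
      rw [Set.disjoint_left] at hd
      grind
    rw [c5] at c4
    simp at c4
    omega
  have a1 := aux K K' hK hdK hK1 hK2
  have a2 := aux K' K (by rw [union_comm]; exact hK) hdK.symm hK2 hK1
  have l1 := h.line (by grind) a1
  have l2 := h.line (by grind) a2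
  have hs := split K K' E X f hK hdK hXE (hfin.subset hXE) hfX
  refine h.two_lines (S1 := X ∩ K) (S2 := X ∩ K') (by grind) (by grind)
    (by rw [Set.disjoint_left] at *; grind) a1 a2 (by omega) (by omega) ?_
  exact (h.mono (by grind)).trans rX

theorem rank_four (h : VCtx E ρ) (hE : ρ E ≤ 4) : E.Finite ∧ E.ncard ≤ 11 := by
  rcases E.eq_empty_or_nonempty with hE0 | ⟨e, he⟩
  · simp [hE0]
  obtain ⟨X, Y, hXY, hd, hX, hY, -⟩ := h.sep e he
  have hXE : X ⊆ E := fun x hx => by have : x ∈ E \ {e} := hXY ▸ Or.inl hx; exact this.1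
  have hYE : Y ⊆ E := fun x hx => by have : x ∈ E \ {e} := hXY ▸ Or.inr hx; exact this.1
  have rX : ρ X ≤ 3 := by
    have : ρ (insert e X) ≤ ρ E := h.mono (by grind)
    omega
  have rY : ρ Y ≤ 3 := by
    have : ρ (insert e Y) ≤ ρ E := h.mono (by grind)
    omega
  have c1 := h.plane hXE rX
  have c2 := h.plane hYE rY
  have hf : E.Finite := by
    refine ((c1.1.union c2.1).insert e).subset ?_
    intro x hx
    have : x ∈ E \ {e} ∨ x = e := by grind
    rw [← hXY] at this
    grind
  refine ⟨hf, ?_⟩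
  have hs := splite X Y E E e hXY hd subset_rfl hf he
  rw [inter_eq_right.2 hXE, inter_eq_right.2 hYE] at hs
  by_contra hcon
  by_cases h6 : X.ncard = 6
  · exact h.rank_four_aux hE hf he hXY hd rX rY h6 (by omega)
  · exact h.rank_four_aux hE hf he (by rw [union_comm]; exact hXY) hd.symm rY rX (by omega) (by omega)


structure Tri (E : Set α) (ρ : Set α → ℕ) (a b c : α) : Prop where
  ha : a ∈ E
  hb : b ∈ E
  hc : c ∈ E
  hab : a ≠ b
  hac : a ≠ c
  hbc : b ≠ c
  hr : ρ {a, b, c} ≤ 2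

theorem Tri.rot {a b c : α} (t : Tri E ρ a b c) : Tri E ρ b c a :=
  ⟨t.hb, t.hc, t.ha, t.hbc, t.hab.symm, t.hac.symm, by
    have : ({b, c, a} : Set α) = {a, b, c} := by ext; grind
    rw [this]; exact t.hr⟩

theorem Tri.flip {a b c : α} (t : Tri E ρ a b c) : Tri E ρ a c b :=
  ⟨t.ha, t.hc, t.hb, t.hac, t.hab, t.hbc.symm, by
    have : ({a, c, b} : Set α) = {a, b, c} := by ext; grind
    rw [this]; exact t.hr⟩

/-- two elements of the triangle span it -/
theorem tspan (h : VCtx E ρ) {a b c : α} (t : Tri E ρ a b c) (x y : α) {X Q : Set α}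
    (hx : x ∈ ({a, b, c} : Set α)) (hy : y ∈ ({a, b, c} : Set α)) (hxy : x ≠ y) (hxX : x ∈ X)
    (hyX : y ∈ X) (hQ : Q ⊆ X ∪ {a, b, c}) : ρ Q ≤ ρ X := by
  have hE : ({a, b, c} : Set α) ⊆ E := by have := t.ha; have := t.hb; have := t.hc; grind
  have := h.pair (hE hx) (hE hy) hxy
  have := t.hr
  exact h.clo (X := {x, y}) (S := {a, b, c}) (by grind) (by grind) (by omega) hQ

theorem conn2 (h : VCtx E ρ) (r4 : 4 ≤ ρ E) {X Q : Set α} (hX : X ⊆ E) (hQ : E ⊆ X ∪ Q)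
    (hr : ρ X ≤ 2) : ρ E ≤ ρ Q := by
  rw [← h.vc2 r4 X hX hr]
  exact h.mono (by grind)

theorem conn (h : VCtx E ρ) (r4 : 4 ≤ ρ E) {X Q : Set α} (hX : X ⊆ E) (hQ : E ⊆ X ∪ Q)
    (hQ3 : 3 ≤ ρ Q) (hr : ρ X + ρ Q ≤ ρ E + 2) : ρ X ≤ 2 ∧ ρ E ≤ ρ Q := by
  have hm : ρ (E \ X) ≤ ρ Q := h.mono (by grind)
  have h1 : ρ X ≤ 2 := by
    by_contra hcon
    by_cases h3 : 3 ≤ ρ (E \ X)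
    · have := h.vc r4 X hX (by omega) h3
      omega
    · have := h.conn2 r4 (X := E \ X) (Q := X) (by grind) (by grind) (by omega)
      omega
  exact ⟨h1, h.conn2 r4 hX hQ h1⟩

structure Sp (E : Set α) (ρ : Set α → ℕ) (a b c : α) (X Y : Set α) : Prop where
  mem : ∀ x, (x ∈ X ∨ x ∈ Y) ↔ (x ∈ E ∧ x ≠ a)
  dis : ∀ x, x ∈ X → x ∉ Y
  rk : ρ X + ρ Y = ρ E + 2
  rX : 3 ≤ ρ X
  rY : 3 ≤ ρ Y
  bX : b ∈ X
  cY : c ∈ Y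
  aX : ρ (insert a X) = ρ X + 1
  aY : ρ (insert a Y) = ρ Y + 1
  cX : ρ (insert c X) = ρ X + 1
  bY : ρ (insert b Y) = ρ Y + 1

theorem Sp.swap {a b c : α} {X Y : Set α} (s : Sp E ρ a b c X Y) : Sp E ρ a c b Y X where
  mem := by have := s.mem; grind
  dis := by have := s.dis; grind
  rk := by have := s.rk; omega
  rX := s.rY
  rY := s.rX
  bX := s.cY
  cY := s.bX
  aX := s.aY
  aY := s.aX
  cX := s.bY
  bY := s.cX

theorem mkSp (h : VCtx E ρ) (r4 : 4 ≤ ρ E) {a b c : α} (t : Tri E ρ a b c) {X Y : Set α}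
    (mem : ∀ x, (x ∈ X ∨ x ∈ Y) ↔ (x ∈ E ∧ x ≠ a)) (dis : ∀ x, x ∈ X → x ∉ Y)
    (rk : ρ X + ρ Y ≤ ρ E + 2) (rX : 3 ≤ ρ X) (rY : 3 ≤ ρ Y) (bX : b ∈ X) : Sp E ρ a b c X Y := by
  obtain ⟨ha, hb, hc, hab, hac, hbc, hr⟩ := t
  have t : Tri E ρ a b c := ⟨ha, hb, hc, hab, hac, hbc, hr⟩
  have u1 := h.unit a X
  have u2 := h.unit a Y
  have u3 := h.unit c X
  have u4 := h.unit b Y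
  have m1 : ρ X ≤ ρ (insert a X) := h.mono (by grind)
  have m2 : ρ Y ≤ ρ (insert a Y) := h.mono (by grind)
  have v1 : ρ E + 3 ≤ ρ (insert a X) + ρ Y := by
    by_contra hcon
    have := h.conn r4 (X := insert a X) (Q := Y) (by grind) (by grind) rY (by omega)
    omega
  have v2 : ρ E + 3 ≤ ρ X + ρ (insert a Y) := by
    by_contra hcon
    have := h.conn r4 (X := insert a Y) (Q := X) (by grind) (by grind) rX (by omega)
    omega
  have cY : c ∈ Y := by
    by_contra hcon
    have : ρ (insert a X) ≤ ρ X := h.tspan t b c (by grind) (by grind) hbc bX (by grind) (by grind)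
    omega
  have s1 : ρ (insert a X) ≤ ρ (insert c X) :=
    h.tspan t b c (by grind) (by grind) hbc (by grind) (by grind) (by grind)
  have s2 : ρ (insert a Y) ≤ ρ (insert b Y) :=
    h.tspan t b c (by grind) (by grind) hbc (by grind) (by grind) (by grind)
  exact ⟨mem, dis, by omega, rX, rY, bX, cY, by omega, by omega, by omega, by omega⟩

theorem exSp (h : VCtx E ρ) (r4 : 4 ≤ ρ E) {a b c : α} (t : Tri E ρ a b c) :
    ∃ X Y, Sp E ρ a b c X Y := by
  obtain ⟨X, Y, hXY, hd, -, -, hh⟩ := h.sep a t.ha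
  obtain ⟨h1, h2, h3⟩ := hh r4
  have hm : ∀ x, (x ∈ X ∨ x ∈ Y) ↔ (x ∈ E ∧ x ≠ a) := by
    intro x
    have : x ∈ X ∪ Y ↔ x ∈ E \ {a} := by rw [hXY]
    grind
  rw [Set.disjoint_left] at hd
  have hb : b ∈ X ∨ b ∈ Y := (hm b).2 ⟨t.hb, t.hab.symm⟩
  rcases hb with hb | hb
  · exact ⟨X, Y, h.mkSp r4 t hm hd h1 h2 h3 hb⟩
  · exact ⟨Y, X, h.mkSp r4 t (by grind) (by grind) (by omega) h3 h2 hb⟩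

theorem coloop (h : VCtx E ρ) (r4 : 4 ≤ ρ E) {a b c : α} (t : Tri E ρ a b c) {X Y : Set α}
    (s : Sp E ρ a b c X Y) (hX : 4 ≤ ρ X) : ρ X ≤ ρ (X \ {b}) := by
  have mem := s.mem
  have bX := s.bX
  have cY := s.cY
  by_contra hcon
  have h1 : ρ (insert a (insert b Y)) ≤ ρ (insert a Y) :=
    h.tspan t a c (by grind) (by grind) t.hac (by grind) (by grind) (by grind)
  have h2 : ρ (insert a Y) ≤ ρ (insert a (insert b Y)) := h.mono (by grind)
  have h3 := s.aY
  have h4 := s.rk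
  have h5 := s.rY
  have h6 := h.conn r4 (X := X \ {b}) (Q := insert a (insert b Y)) (by grind) (by grind)
    (by omega) (by omega)
  have h7 := h.unit b (X \ {b})
  have h8 : ρ X ≤ ρ (insert b (X \ {b})) := h.mono (by grind)
  omega

theorem pairlem (h : VCtx E ρ) (r4 : 4 ≤ ρ E) {a b c : α} (t : Tri E ρ a b c)
    {A1 A2 B1 B2 : Set α} (s : Sp E ρ a b c A1 A2) (s' : Sp E ρ b a c B1 B2)
    (hA1 : 4 ≤ ρ A1) (hA2 : 4 ≤ ρ A2) (hB1 : 4 ≤ ρ B1) (hB2 : 4 ≤ ρ B2) :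
    ρ (A1 ∩ B2) = 2 ∧ ρ (A2 ∩ B1) = 2 ∧ ρ A1 = ρ B1 ∧ ρ A2 = ρ B2 ∧
      (ρ (A1 ∩ B1) ≤ 2 ∨ ρ (A2 ∩ B2) ≤ 2) := by
  have c1 := h.coloop r4 t s hA1
  have c2 := h.coloop r4 t.rot.flip s' hB1
  obtain ⟨m, d, k, -, -, bA, cA, -, -, -, -⟩ := s
  obtain ⟨m', d', k', -, -, aB, cB, -, -, -, -⟩ := s'
  have i1 := h.sub A1 B1
  have i2 := h.sub A2 B2
  have i3 := h.sub A1 B2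
  have i4 := h.sub A2 B1
  have j1 : ρ (insert a (insert b (A2 ∪ B2))) ≤ ρ (insert a (A2 ∪ B2)) :=
    h.tspan t a c (by grind) (by grind) t.hac (by grind) (by grind) (by grind)
  have j1' := h.unit a (A2 ∪ B2)
  have j2 : ρ (insert b (A2 ∪ B1)) ≤ ρ (A2 ∪ B1) :=
    h.tspan t a c (by grind) (by grind) t.hac (by grind) (by grind) (by grind)
  have j3 : ρ (insert a (A1 ∪ B2)) ≤ ρ (A1 ∪ B2) :=
    h.tspan t b c (by grind) (by grind) t.hbc (by grind) (by grind) (by grind)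
  have n1 : ρ A1 ≤ ρ (A1 ∪ B1) := h.mono (by grind)
  have n2 : ρ A2 ≤ ρ (insert a (insert b (A2 ∪ B2))) := h.mono (by grind)
  have n3 : ρ A2 ≤ ρ (insert b (A2 ∪ B1)) := h.mono (by grind)
  have n4 : ρ A1 ≤ ρ (insert a (A1 ∪ B2)) := h.mono (by grind)
  have disj : ρ (A1 ∩ B1) ≤ 2 ∨ ρ (A2 ∩ B2) ≤ 2 := by
    by_contra hcon
    have q1 := h.conn r4 (X := A2 ∩ B2) (Q := A1 ∪ B1) (by grind) (by grind) (by omega)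
    have q2 := h.conn r4 (X := A1 ∩ B1) (Q := insert a (insert b (A2 ∪ B2))) (by grind)
      (by grind) (by omega)
    omega
  have e1 : 2 ≤ ρ (A2 ∩ B1) := by
    have u1 := h.un (X := A1 ∩ B1) (Y := A2 ∩ B1) (Q := B1 \ {a}) (by grind)
    have u2 := h.un (X := A2 ∩ B2) (Y := A2 ∩ B1) (Q := A2) (by grind)
    omega
  have e2 : 2 ≤ ρ (A1 ∩ B2) := by
    have u1 := h.un (X := A1 ∩ B1) (Y := A1 ∩ B2) (Q := A1 \ {b}) (by grind)
    have u2 := h.un (X := A2 ∩ B2) (Y := A1 ∩ B2) (Q := B2) (by grind)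
    omega
  have q1 := h.conn r4 (X := A1 ∩ B2) (Q := insert b (A2 ∪ B1)) (by grind) (by grind) (by omega)
  have q2 := h.conn r4 (X := A2 ∩ B1) (Q := insert a (A1 ∪ B2)) (by grind) (by grind) (by omega)
  have q3 := h.conn2 r4 (X := A1 ∩ B2) (Q := insert b (A2 ∪ B1)) (by grind) (by grind)
  have q4 := h.conn2 r4 (X := A2 ∩ B1) (Q := insert a (A1 ∪ B2)) (by grind) (by grind)
  omega

def Big (E : Set α) (ρ : Set α → ℕ) (a b c : α) : Prop :=
  ∀ X Y, Sp E ρ a b c X Y → 4 ≤ ρ X ∧ 4 ≤ ρ Y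

theorem Big.flip {a b c : α} (hb : Big E ρ a b c) : Big E ρ a c b :=
  fun X Y s => (hb Y X s.swap).symm

theorem cyc (h : VCtx E ρ) (r4 : 4 ≤ ρ E) {a b c : α} (t : Tri E ρ a b c)
    {U U' V V' : Set α} (s : Sp E ρ a b c U U') (s' : Sp E ρ b c a V V')
    (b1 : Big E ρ a b c) (b2 : Big E ρ b c a) :
    ρ (U ∩ V) = 2 ∧ ρ (U' ∩ V') = 2 ∧ ρ U = ρ V' ∧ ρ U' = ρ V ∧
      (ρ (U ∩ V') ≤ 2 ∨ ρ (U' ∩ V) ≤ 2) :=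
  h.pairlem r4 t s s'.swap (b1 _ _ s).1 (b1 _ _ s).2 (b2 _ _ s').2 (b2 _ _ s').1

theorem knon (h : VCtx E ρ) (r4 : 4 ≤ ρ E) {a b c : α} (t : Tri E ρ a b c)
    {U U' V V' W W' : Set α} (sA : Sp E ρ a b c U U') (sB : Sp E ρ b c a V V')
    (sC : Sp E ρ c a b W W')
    (b1 : Big E ρ a b c) (b2 : Big E ρ b c a) (b3 : Big E ρ c a b) :
    ∃ k, k ∈ U ∧ k ∈ V ∧ k ∈ W := by
  by_contra hK
  push Not at hK
  obtain ⟨x1, x2, x3, x4, x5⟩ := h.cyc r4 t sA sB b1 b2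
  obtain ⟨y1, y2, y3, y4, y5⟩ := h.cyc r4 t.rot sB sC b2 b3
  obtain ⟨z1, z2, z3, z4, z5⟩ := h.cyc r4 t.rot.rot sC sA b3 b1
  have hkA := sA.rk
  have hkB := sB.rk
  have hA := b1 _ _ sA
  have naU := sA.aX
  have ncW := sC.aX
  have sA0 := sA
  obtain ⟨mA, dA, -, -, -, bU, cU', -, -, -, -⟩ := sA
  obtain ⟨mB, dB, -, -, -, cV, aV', -, -, -, -⟩ := sB
  obtain ⟨mC, dC, -, -, -, aW, bW', -, -, -, -⟩ := sC
  have e1 : 3 ≤ ρ (insert a (W ∩ U)) := by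
    by_contra hcon
    have : ρ (insert a U) ≤ ρ U :=
      h.clo (X := W ∩ U) (S := insert a (W ∩ U)) (by grind) (by grind) (by omega) (by grind)
    omega
  have e2 : 3 ≤ ρ (insert c (V ∩ W)) := by
    by_contra hcon
    have : ρ (insert c W) ≤ ρ W :=
      h.clo (X := V ∩ W) (S := insert c (V ∩ W)) (by grind) (by grind) (by omega) (by grind)
    omega
  have e3 : ρ (insert a (W ∩ U)) ≤ ρ (V' ∩ W) := h.mono (by grind)
  have e4 : ρ (V ∩ W') ≤ 2 := by omega
  have f1 : ρ (U ∪ (U' ∩ (V ∩ W'))) ≤ ρ U :=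
    h.clo (X := U ∩ V) (S := V ∩ W') (by grind) (by grind) (by omega) (by grind)
  have f1' : ρ U ≤ ρ (U ∪ (U' ∩ (V ∩ W'))) := h.mono (by grind)
  have f2 : ρ (insert c (V ∩ W)) ≤ ρ (U' \ (V ∩ W')) := h.mono (by grind)
  have f3 : ρ (U' \ (V ∩ W')) ≤ ρ U' := h.mono (by grind)
  have s : Sp E ρ a b c (U ∪ (U' ∩ (V ∩ W'))) (U' \ (V ∩ W')) :=
    h.mkSp r4 t (by grind) (by grind) (by omega) (by omega) (by omega) (by grind)
  have g1 := h.coloop r4 t.flip s.swap (b1 _ _ s).2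
  have g2 : ρ (insert c (V' ∪ W)) ≤ ρ (V' ∪ W) :=
    h.clo (X := (U' \ (V ∩ W')) \ {c}) (S := U' \ (V ∩ W')) (by grind) (by grind) g1 (by grind)
  have g3 : ρ (insert b (insert c (V' ∪ W))) ≤ ρ (insert c (V' ∪ W)) :=
    h.tspan t a c (by grind) (by grind) t.hac (by grind) (by grind) (by grind)
  have g4 := h.conn2 r4 (X := V ∩ W') (Q := insert b (insert c (V' ∪ W))) (by grind) (by grind) e4
  have g5 := h.sub V' W
  omega

theorem star_aux (h : VCtx E ρ) (r4 : 4 ≤ ρ E) {a b c : α} (t : Tri E ρ a b c)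
    {U U' V V' W W' : Set α} (sA : Sp E ρ a b c U U') (sB : Sp E ρ b c a V V')
    (sC : Sp E ρ c a b W W')
    (b1 : Big E ρ a b c) (b2 : Big E ρ b c a) (b3 : Big E ρ c a b) {k : α}
    (hkU : k ∈ U) (hkV : k ∈ V) (hkW : k ∈ W) (hk : ∀ x, x ∈ U → x ∈ V → x ∈ W → x = k) :
    (((U ∩ V) \ {k}) : Set α).Subsingleton := by
  intro x hx y hy
  by_contra hxy
  have x1 := (h.cyc r4 t sA sB b1 b2).1
  have hC := b3 _ _ sC
  have hCr := sC.rk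
  have mA := sA.mem
  have dA := sA.dis
  have mB := sB.mem
  have mC := sC.mem
  have dC := sC.dis
  have aW := sC.bX
  have cU' := sA.cY
  have p := h.pairle (X := {x, y}) (x := x) (y := y) (by grind) (by grind) (by grind) hxy
  have f1 : ρ (insert k W') ≤ ρ W' :=
    h.clo (X := {x, y}) (S := U ∩ V) (by grind) (by grind) (by omega) (by grind)
  have f2 : ρ W' ≤ ρ (insert k W') := h.mono (by grind)
  have f3 := h.unit k (W \ {k})
  have f4 : ρ W ≤ ρ (insert k (W \ {k})) := h.mono (by grind)
  have f5 : ρ (W \ {k}) ≤ ρ W := h.mono (by grind)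
  have s : Sp E ρ c a b (W \ {k}) (insert k W') :=
    h.mkSp r4 t.rot.rot (by grind) (by grind) (by omega) (by omega) (by omega) (by grind)
  obtain ⟨j, hj⟩ := h.knon r4 t sA sB s b1 b2 b3
  grind

theorem star (h : VCtx E ρ) (r4 : 4 ≤ ρ E) {a b c : α} (t : Tri E ρ a b c)
    {U U' V V' W W' : Set α} (sA : Sp E ρ a b c U U') (sB : Sp E ρ b c a V V')
    (sC : Sp E ρ c a b W W')
    (b1 : Big E ρ a b c) (b2 : Big E ρ b c a) (b3 : Big E ρ c a b) :
    ((U ∩ V) ∪ (V ∩ W) ∪ (W ∩ U)).Finite ∧ ((U ∩ V) ∪ (V ∩ W) ∪ (W ∩ U)).ncard ≤ 4 := by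
  obtain ⟨k, kU, kV, kW⟩ := h.knon r4 t sA sB sC b1 b2 b3
  have mA := sA.mem
  have mB := sB.mem
  have mC := sC.mem
  by_cases hk : ∀ x, x ∈ U → x ∈ V → x ∈ W → x = k
  · have q1 := h.star_aux r4 t sA sB sC b1 b2 b3 kU kV kW hk
    have q2 := h.star_aux r4 t.rot sB sC sA b2 b3 b1 kV kW kU (by grind)
    have q3 := h.star_aux r4 t.rot.rot sC sA sB b3 b1 b2 kW kU kV (by grind)
    have hs : (U ∩ V) ∪ (V ∩ W) ∪ (W ∩ U) ⊆
        insert k (((U ∩ V) \ {k}) ∪ ((V ∩ W) \ {k}) ∪ ((W ∩ U) \ {k})) := by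
      intro x hx
      by_cases x = k <;> grind
    have hf : (insert k (((U ∩ V) \ {k}) ∪ ((V ∩ W) \ {k}) ∪ ((W ∩ U) \ {k}))).Finite :=
      ((q1.finite.union q2.finite).union q3.finite).insert k
    refine ⟨hf.subset hs, (Set.ncard_le_ncard hs hf).trans ?_⟩
    have c1 := card1.ncard_le_one_of_subsingleton_fix q1
    have c2 := card1.ncard_le_one_of_subsingleton_fix q2
    have c3 := card1.ncard_le_one_of_subsingleton_fix q3
    have c4 := Set.ncard_insert_le k (((U ∩ V) \ {k}) ∪ ((V ∩ W) \ {k}) ∪ ((W ∩ U) \ {k}))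
    have c5 := Set.ncard_union_le (((U ∩ V) \ {k}) ∪ ((V ∩ W) \ {k})) ((W ∩ U) \ {k})
    have c6 := Set.ncard_union_le ((U ∩ V) \ {k}) ((V ∩ W) \ {k})
    omega
  · push Not at hk
    obtain ⟨x, xU, xV, xW, hxk⟩ := hk
    have x1 := (h.cyc r4 t sA sB b1 b2).1
    have y1 := (h.cyc r4 t.rot sB sC b2 b3).1
    have z1 := (h.cyc r4 t.rot.rot sC sA b3 b1).1
    have p := h.pairle (X := {x, k}) (x := x) (y := k) (by grind) (by grind) (by grind) hxk
    have f1 : ρ ((U ∩ V) ∪ (V ∩ W)) ≤ ρ (U ∩ V) :=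
      h.clo (X := {x, k}) (S := V ∩ W) (by grind) (by grind) (by omega) (by grind)
    have f2 : ρ ((U ∩ V) ∪ (V ∩ W) ∪ (W ∩ U)) ≤ ρ ((U ∩ V) ∪ (V ∩ W)) :=
      h.clo (X := {x, k}) (S := W ∩ U) (by grind) (by grind) (by omega) (by grind)
    have := h.line (L := (U ∩ V) ∪ (V ∩ W) ∪ (W ∩ U)) (by grind) (by omega)
    exact ⟨this.1, by omega⟩

theorem propB (h : VCtx E ρ) (r4 : 4 ≤ ρ E) {a b c : α} (t : Tri E ρ a b c)
    (b1 : Big E ρ a b c) (b2 : Big E ρ b c a) (b3 : Big E ρ c a b) :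
    E.Finite ∧ E.ncard ≤ 11 := by
  obtain ⟨U, U', sA⟩ := h.exSp r4 t
  obtain ⟨V, V', sB⟩ := h.exSp r4 t.rot
  obtain ⟨W, W', sC⟩ := h.exSp r4 t.rot.rot
  have q1 := h.star r4 t sA sB sC b1 b2 b3
  have q2 := h.star r4 t.flip sA.swap sC.swap sB.swap b1.flip b3.flip b2.flip
  have mA := sA.mem
  have mB := sB.mem
  have mC := sC.mem
  have hs : E ⊆ insert a (insert b (insert c (((U ∩ V) ∪ (V ∩ W) ∪ (W ∩ U)) ∪
      ((U' ∩ W') ∪ (W' ∩ V') ∪ (V' ∩ U'))))) := by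
    intro x hx
    have := mA x
    have := mB x
    have := mC x
    clear q1 q2 mA mB mC
    grind
  have hf := (((q1.1.union q2.1).insert c).insert b).insert a
  refine ⟨hf.subset hs, (Set.ncard_le_ncard hs hf).trans ?_⟩
  have c1 := Set.ncard_union_le ((U ∩ V) ∪ (V ∩ W) ∪ (W ∩ U)) ((U' ∩ W') ∪ (W' ∩ V') ∪ (V' ∩ U'))
  refine (Set.ncard_insert_le _ _).trans ?_
  have c2 := Set.ncard_insert_le b (insert c (((U ∩ V) ∪ (V ∩ W) ∪ (W ∩ U)) ∪
      ((U' ∩ W') ∪ (W' ∩ V') ∪ (V' ∩ U'))))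
  have c3 := Set.ncard_insert_le c (((U ∩ V) ∪ (V ∩ W) ∪ (W ∩ U)) ∪
      ((U' ∩ W') ∪ (W' ∩ V') ∪ (V' ∩ U')))
  omega

structure CoCtx (E : Set α) (ρ : Set α → ℕ) (Co : Set α → Prop) : Prop where
  ex : ∀ X ⊆ E, ρ X < ρ E → ∃ D, Co D ∧ ∀ x ∈ D, x ∉ X
  sub : ∀ D, Co D → D ⊆ E
  hyp : ∀ D, Co D → ρ (E \ D) + 1 = ρ E
  out : ∀ D, Co D → ∀ e ∈ D, ρ (insert e (E \ D)) = ρ E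

def Gl (ρ : Set α → ℕ) (Co : Set α → Prop) (T : Set α) : Prop :=
  ∃ D, Co D ∧ D.Finite ∧ (D ∩ T).ncard = 2 ∧
    (D.ncard = 4 ∨ (D.ncard = 5 ∧ ∃ L ⊆ D, L.ncard = 3 ∧ ρ L ≤ 2))

variable {Co : Set α → Prop}

theorem orth (h : VCtx E ρ) (co : CoCtx E ρ Co) {a b c : α} (t : Tri E ρ a b c) {D : Set α}
    (hD : Co D) (ha : a ∈ D) (hb : b ∉ D) : c ∈ D := by
  by_contra hc
  have := t.hb
  have := t.hc
  have h1 : ρ (insert a (E \ D)) ≤ ρ (E \ D) :=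
    h.tspan t b c (by grind) (by grind) t.hbc (by grind) (by grind) (by grind)
  have := co.out D hD a ha
  have := co.hyp D hD
  omega

theorem cork (h : VCtx E ρ) (co : CoCtx E ρ Co) (r5 : 5 ≤ ρ E) {D : Set α} (hD : Co D) :
    4 ≤ ρ D := by
  have h1 := co.sub D hD
  have h2 := co.hyp D hD
  by_contra hcon
  have := h.conn (by omega) (X := D) (Q := E \ D) h1 (by grind) (by omega) (by omega)
  omega

theorem inter2 (h : VCtx E ρ) (co : CoCtx E ρ Co) {a b c : α} (t : Tri E ρ a b c) {D : Set α}
    (hD : Co D) (ha : a ∈ D) (hb : b ∉ D) : (D ∩ {a, b, c}).ncard = 2 := by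
  have hc := h.orth co t hD ha hb
  have : D ∩ {a, b, c} = {a, c} := by ext x; grind
  rw [this, Set.ncard_pair t.hac]

theorem finish (h : VCtx E ρ) (co : CoCtx E ρ Co) (r5 : 5 ≤ ρ E) {a b c : α} (t : Tri E ρ a b c)
    {D L : Set α} {p q x y : α} (hD : Co D) (hL : L ⊆ E) (hr : ρ L ≤ 2)
    (hDL : D ⊆ insert p (insert q L)) (hx : x ∈ ({a, b, c} : Set α))
    (hy : y ∈ ({a, b, c} : Set α)) (hxD : x ∈ D) (hyD : y ∉ D) : Gl ρ Co {a, b, c} := by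
  obtain ⟨lf, lc⟩ := h.line hL hr
  have hf : (insert p (insert q L)).Finite := (lf.insert q).insert p
  have hDf := hf.subset hDL
  have c1 := Set.ncard_le_ncard hDL hf
  have c2 := Set.ncard_insert_le p (insert q L)
  have c3 := Set.ncard_insert_le q L
  have c4 := h.rk_le_card hDf
  have c5 := h.cork co r5 hD
  refine ⟨D, hD, hDf, ?_, ?_⟩
  · obtain ⟨z, t', hz⟩ : ∃ z, Tri E ρ x y z ∧ ({x, y, z} : Set α) = {a, b, c} := by
      have hxy : x ≠ y := by grind
      have e1 : ({b, c, a} : Set α) = {a, b, c} := by ext; grind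
      have e2 : ({c, a, b} : Set α) = {a, b, c} := by ext; grind
      have e3 : ({a, c, b} : Set α) = {a, b, c} := by ext; grind
      have e4 : ({b, a, c} : Set α) = {a, b, c} := by ext; grind
      have e5 : ({c, b, a} : Set α) = {a, b, c} := by ext; grind
      rcases hx with rfl | rfl | rfl <;> rcases hy with rfl | rfl | rfl
      · exact absurd rfl hxy
      · exact ⟨_, t, rfl⟩
      · exact ⟨_, t.flip, e3⟩
      · exact ⟨_, t.rot.flip, e4⟩
      · exact absurd rfl hxy
      · exact ⟨_, t.rot, e1⟩
      · exact ⟨_, t.rot.rot, e2⟩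
      · exact ⟨_, t.rot.rot.flip, e5⟩
      · exact absurd rfl hxy
    rw [← hz]
    exact h.inter2 co t' hD hxD hyD
  · by_cases h4 : D.ncard = 4
    · exact Or.inl h4
    · refine Or.inr ⟨by omega, L, ?_, by omega, hr⟩
      have : D = insert p (insert q L) := Set.eq_of_subset_of_ncard_le hDL (by omega) hf
      rw [this]
      grind

structure PC (ρ : Set α → ℕ) (Co : Set α → Prop) (a b c : α) (D : Set α) : Prop where
  co : Co D
  aD : a ∈ D
  cD : c ∈ D
  bD : b ∉ D
  rk : ρ (D \ {a}) = 3

theorem planeco (h : VCtx E ρ) (co : CoCtx E ρ Co) (r5 : 5 ≤ ρ E) {a b c : α} (t : Tri E ρ a b c)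
    {X Y : Set α} (s : Sp E ρ a b c X Y) (hY : ρ Y = 3) : ∃ D, PC ρ Co a b c D := by
  have hm := s.mem
  have hk := s.rk
  have hb := s.bX
  obtain ⟨D, hD, hDX⟩ := co.ex X (by grind) (by omega)
  have hDE := co.sub D hD
  have hr := h.cork co r5 hD
  have haD : a ∈ D := by
    by_contra hcon
    have : ρ D ≤ ρ Y := h.mono (by grind)
    omega
  have hbD : b ∉ D := by grind
  have h1 : ρ (D \ {a}) ≤ ρ Y := h.mono (by grind)
  have h2 := h.unit a (D \ {a})
  have h3 : ρ D ≤ ρ (insert a (D \ {a})) := h.mono (by grind)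
  exact ⟨D, hD, haD, h.orth co t hD haD hbD, hbD, by omega⟩

theorem lem1 (h : VCtx E ρ) (co : CoCtx E ρ Co) (r5 : 5 ≤ ρ E) {a b c : α} (t : Tri E ρ a b c)
    (hG : ¬ Gl ρ Co {a, b, c}) {D X Y : Set α} (pc : PC ρ Co a b c D) (s : Sp E ρ b a c X Y) :
    ρ Y = 3 := by
  obtain ⟨hD, aD, cD, bD, rZ⟩ := pc
  have hDE := co.sub D hD
  have hH := co.hyp D hD
  have hHa := co.out D hD a aD
  have hHc := co.out D hD c cD
  obtain ⟨m, d, k, rX, rY, aX, cY, -, nY, nX, -⟩ := s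
  obtain ⟨ha, hb, hc, hab, hac, hbc, -⟩ := id t
  have hYE : ρ (insert b Y) ≤ ρ E := h.mono (by grind)
  by_cases hcase : 3 ≤ ρ ((D \ {a}) ∩ Y)
  · exfalso
    have f1 : ρ (Y ∪ (D \ {a})) ≤ ρ Y :=
      h.clo (X := (D \ {a}) ∩ Y) (S := D \ {a}) (by grind) (by grind) (by omega) (by grind)
    have f1' : ρ Y ≤ ρ (insert b (insert a (Y ∪ (D \ {a})))) := h.mono (by grind)
    have f2 : ρ (X \ D) + 1 ≤ ρ X := by
      have u : ρ (insert a (X \ D)) ≤ ρ X := h.mono (by grind)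
      by_contra hcon
      have : ρ (insert a (E \ D)) ≤ ρ (E \ D) :=
        h.clo (X := X \ D) (S := insert a (X \ D)) (by grind) (by grind) (by omega) (by grind)
      omega
    have f3 : ρ (insert b (insert a (Y ∪ (D \ {a})))) ≤ ρ (insert a (Y ∪ (D \ {a}))) :=
      h.tspan t a c (by grind) (by grind) hac (by grind) (by grind) (by grind)
    have f4 := h.unit a (Y ∪ (D \ {a}))
    have f5 := h.conn (by omega) (X := X \ D) (Q := insert b (insert a (Y ∪ (D \ {a}))))
      (by grind) (by
        intro x hx
        have := m x
        by_cases hxa : x = a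
        · grind
        · have : x ∈ D → x ∈ D \ {a} := fun h => ⟨h, hxa⟩
          grind) (by omega) (by omega)
    obtain ⟨D', hD', hdis⟩ := co.ex (Y ∪ (D \ {a})) (by grind) (by omega)
    have hD'E := co.sub D' hD'
    have hr := h.cork co r5 hD'
    have haD' : a ∈ D' := by
      by_contra hcon
      have u1 : ρ D' ≤ ρ (insert b (X \ D)) := h.mono (by grind)
      have u2 := h.unit b (X \ D)
      omega
    exact hG (h.finish co r5 t (p := a) (q := b) (x := a) (y := c) hD' (L := X \ D) (by grind) f5.1
      (by grind) (by grind) (by grind) haD' (by grind))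
  · have g1 : ρ ((D \ {a}) ∩ X) ≤ 2 := by
      by_contra hcon
      have : ρ (insert c X) ≤ ρ X :=
        h.clo (X := (D \ {a}) ∩ X) (S := D \ {a}) (by grind) (by grind) (by omega) (by grind)
      omega
    have key : ∀ P Q : Set α, P ⊆ E → Q ⊆ E → D \ {a} ⊆ P ∪ Q → ρ P ≤ 2 → 2 ≤ ρ Q := by
      intro P Q hP hQ hPQ hPr
      by_contra hcon
      have hs := h.subsing hQ (by omega)
      obtain ⟨q, hq⟩ : ∃ q, Q ⊆ {q} := by
        rcases Q.eq_empty_or_nonempty with rfl | ⟨q, hq⟩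
        · exact ⟨a, by simp⟩
        · exact ⟨q, fun x hx => hs hx hq⟩
      exact hG (h.finish co r5 t (p := a) (q := q) (x := a) (y := b) hD (L := P) hP hPr
        (by
          intro x hx
          by_cases hxa : x = a
          · grind
          · have := hPQ (show x ∈ D \ {a} from ⟨hx, hxa⟩)
            grind) (by grind) (by grind) aD bD)
    have k1 := key ((D \ {a}) ∩ Y) ((D \ {a}) ∩ X) (by grind) (by grind) (by grind) (by omega)
    have k2 := key ((D \ {a}) ∩ X) ((D \ {a}) ∩ Y) (by grind) (by grind) (by grind) (by omega)
    have f1 : ρ ((D \ {a}) ∪ X) + ρ ((D \ {a}) ∩ X) ≤ ρ (D \ {a}) + ρ X := h.sub _ _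
    have f2 : ρ (insert b ((D \ {a}) ∪ X)) ≤ ρ ((D \ {a}) ∪ X) :=
      h.tspan t a c (by grind) (by grind) hac (by grind) (by grind) (by grind)
    have f2' : ρ X ≤ ρ (insert b ((D \ {a}) ∪ X)) := h.mono (by grind)
    have f3 := h.sm (X := E \ D) (Y := Y) (P := Y \ D) (Q := insert c (E \ D)) (by grind)
      (by grind) (by grind)
    have f4 := h.conn (by omega) (X := Y \ D) (Q := insert b ((D \ {a}) ∪ X)) (by grind) (by grind)
      (by omega) (by omega)
    omega

theorem propA (h : VCtx E ρ) (co : CoCtx E ρ Co) (r5 : 5 ≤ ρ E) {a b c : α} (t : Tri E ρ a b c)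
    (hG : ¬ Gl ρ Co {a, b, c}) {X Y : Set α} (sA : Sp E ρ a b c X Y) : 4 ≤ ρ Y := by
  by_contra hY
  have hY3 : ρ Y = 3 := by have := sA.rY; omega
  have e2 : ({c, a, b} : Set α) = {a, b, c} := by ext; grind
  have e5 : ({c, b, a} : Set α) = {a, b, c} := by ext; grind
  obtain ⟨D, pc⟩ := h.planeco co r5 t sA hY3
  obtain ⟨B1, B2, sB⟩ := h.exSp (by omega) t.rot.flip
  have hB2 := h.lem1 co r5 t hG pc sB
  obtain ⟨C1, C2, sC⟩ := h.exSp (by omega) t.rot.rot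
  have hC2 : 4 ≤ ρ C2 := by
    by_contra hcon
    obtain ⟨D2, pc2⟩ := h.planeco co r5 t.rot.rot sC (by have := sC.rY; omega)
    have := h.lem1 co r5 t.rot.rot (by rw [e2]; exact hG) pc2 sA.swap
    have := sA.rk
    omega
  have hC1 : 4 ≤ ρ C1 := by
    by_contra hcon
    obtain ⟨D2, pc2⟩ := h.planeco co r5 t.rot.rot.flip sC.swap (by have := sC.rX; omega)
    have := h.lem1 co r5 t.rot.rot.flip (by rw [e5]; exact hG) pc2 sB.swap
    have := sB.rk
    omega
  have hcol := h.coloop (by omega) t.rot.rot.flip sC.swap hC2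
  obtain ⟨hD, aD, cD, bD, rZ⟩ := pc
  have hDE := co.sub D hD
  have hH := co.hyp D hD
  have hHa := co.out D hD a aD
  obtain ⟨m, d, k, -, -, aC, bC, nC1, -, -, -⟩ := sC
  obtain ⟨ha, hb, hc, hab, hac, hbc, -⟩ := id t
  clear sA sB
  by_cases hcase : 2 ≤ ρ ((D \ {a}) ∩ C2)
  · have f1 : ρ ((D \ {a}) ∪ C2) + ρ ((D \ {a}) ∩ C2) ≤ ρ (D \ {a}) + ρ C2 := h.sub _ _
    have f2 : ρ (insert a ((D \ {a}) ∪ C2)) ≤ ρ ((D \ {a}) ∪ C2) :=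
      h.tspan t b c (by grind) (by grind) hbc (by grind) (by grind) (by grind)
    have f2' : ρ C2 ≤ ρ (insert a ((D \ {a}) ∪ C2)) := h.mono (by grind)
    have f3 := h.sm (X := E \ D) (Y := C1) (P := C1 \ D) (Q := insert a (E \ D)) (by grind)
      (by grind) (by grind)
    have f4 := h.conn (by omega) (X := C1 \ D) (Q := insert a ((D \ {a}) ∪ C2)) (by grind)
      (by grind) (by omega) (by omega)
    omega
  · have hs := h.subsing (X := (D \ {a}) ∩ C2) (by grind) (by omega)
    rcases ((D \ {a}) ∩ C2).eq_empty_or_nonempty with h0 | ⟨p, hp⟩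
    · have hsub : (D \ {a}) \ {c} ⊆ C1 := by
        intro x hx
        have : x ∉ (D \ {a}) ∩ C2 := by rw [h0]; simp
        grind
      have g1 : ρ ((D \ {a}) \ {c}) ≤ 2 := by
        by_contra hcon
        have : ρ (insert c C1) ≤ ρ C1 :=
          h.clo (X := (D \ {a}) \ {c}) (S := D \ {a}) hsub (by grind) (by omega) (by grind)
        omega
      exact hG (h.finish co r5 t (p := a) (q := c) (x := a) (y := b) hD (L := (D \ {a}) \ {c})
        (by grind) g1 (by grind) (by grind) (by grind) aD bD)
    · have hu : ∀ x, x ∈ D → x ≠ a → x ∈ C2 → x = p := fun x h1 h2 h3 => hs ⟨⟨h1, h2⟩, h3⟩ hp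
      have hHp := co.out D hD p hp.1.1
      have g1 : 3 ≤ ρ ((D \ {a}) \ {p}) := by
        by_contra hcon
        exact hG (h.finish co r5 t (p := a) (q := p) (x := a) (y := b) hD (L := (D \ {a}) \ {p})
          (by grind) (by omega) (by grind) (by grind) (by grind) aD bD)
      have g2 : ρ (C2 \ {p, b}) + 1 ≤ ρ C2 := by
        by_contra hcon
        have : ρ (insert p (E \ D)) ≤ ρ (E \ D) :=
          h.clo (X := C2 \ {p, b}) (S := C2) (by grind) (by grind) (by omega) (by grind)
        omega
      have g3 : ρ (insert p (insert b (insert c C1))) ≤ ρ (insert b (insert c C1)) :=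
        h.clo (X := (D \ {a}) \ {p}) (S := D \ {a}) (by grind) (by grind) (by omega) (by grind)
      have g4 : ρ (insert b (insert c C1)) ≤ ρ (insert c C1) :=
        h.tspan t a c (by grind) (by grind) hac (by grind) (by grind) (by grind)
      have g4' : ρ C1 ≤ ρ (insert p (insert b (insert c C1))) := h.mono (by grind)
      have g5 := h.conn (by omega) (X := C2 \ {p, b}) (Q := insert p (insert b (insert c C1)))
        (by grind) (by grind) (by omega) (by omega)
      have g6 := h.unit p (C2 \ {p, b})
      have g7 : ρ (C2 \ {b}) ≤ ρ (insert p (C2 \ {p, b})) := h.mono (by grind)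
      omega

theorem main (h : VCtx E ρ) (co : CoCtx E ρ Co) {a b c : α} (t : Tri E ρ a b c) :
    Gl ρ Co {a, b, c} ∨ (E.Finite ∧ E.ncard ≤ 11) := by
  by_cases r4 : ρ E ≤ 4
  · exact Or.inr (h.rank_four r4)
  by_cases hG : Gl ρ Co {a, b, c}
  · exact Or.inl hG
  have big : ∀ a b c : α, Tri E ρ a b c → ¬ Gl ρ Co {a, b, c} → Big E ρ a b c := by
    intro a b c t hG X Y s
    refine ⟨h.propA co (by omega) t.flip ?_ s.swap, h.propA co (by omega) t hG s⟩
    have : ({a, c, b} : Set α) = {a, b, c} := by ext; grind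
    rw [this]; exact hG
  have e1 : ({b, c, a} : Set α) = {a, b, c} := by ext; grind
  have e2 : ({c, a, b} : Set α) = {a, b, c} := by ext; grind
  exact Or.inr (h.propB (by omega) t (big _ _ _ t hG) (big _ _ _ t.rot (by rw [e1]; exact hG))
    (big _ _ _ t.rot.rot (by rw [e2]; exact hG)))
end VCtx

theorem VCtx.mk_of {E : Set α} {ρ : Set α → ℕ}
    (mono : ∀ {X Y : Set α}, X ⊆ Y → ρ X ≤ ρ Y)
    (sub : ∀ X Y : Set α, ρ (X ∪ Y) + ρ (X ∩ Y) ≤ ρ X + ρ Y)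
    (unit : ∀ e X, ρ (insert e X) ≤ ρ X + 1) (emp : ρ ∅ = 0) (h2 : 2 ≤ ρ E)
    (hV : ∀ (j : ℕ) (X Y : Set α), 0 < j → j < 4 → X ∪ Y = E → Disjoint X Y →
      ρ X + ρ Y < ρ E + j → j ≤ ρ X → j ≤ ρ Y → False)
    (hD : ∀ e ∈ E, ∃ (j : ℕ) (X Y : Set α), 0 < j ∧ j < 4 ∧ X ∪ Y = E \ {e} ∧ Disjoint X Y ∧
      ρ X + ρ Y < ρ (E \ {e}) + j ∧ j ≤ ρ X ∧ j ≤ ρ Y) : VCtx E ρ := by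
  have noc : ∀ e ∈ E, ρ (E \ {e}) = ρ E := by
    intro e he
    by_contra hne
    have h1 : ρ (E \ {e}) ≤ ρ E := mono sdiff_subset
    have hu : {e} ∪ E \ {e} = E := by
      ext x; by_cases hx : x = e <;> simp [hx, he]
    have h3 := sub {e} (E \ {e})
    rw [hu] at h3
    have h4 := unit e ∅
    have h5 : insert e (∅ : Set α) = {e} := by simp
    rw [h5, emp] at h4
    exact hV 1 {e} (E \ {e}) (by omega) (by omega) hu (by simp) (by omega) (by omega) (by omega)
  have sepj : ∀ e ∈ E, ∃ (j : ℕ) (X Y : Set α), 0 < j ∧ j < 4 ∧ X ∪ Y = E \ {e} ∧ Disjoint X Y ∧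
      ρ X + ρ Y < ρ E + j ∧ j ≤ ρ X ∧ j ≤ ρ Y ∧ ρ X < ρ (insert e X) ∧ ρ Y < ρ (insert e Y) ∧
      insert e X ∪ Y = E ∧ X ∪ insert e Y = E ∧ Disjoint (insert e X) Y ∧
      Disjoint X (insert e Y) := by
    intro e he
    obtain ⟨j, X, Y, h0, h4, hu, hd, hl, hX, hY⟩ := hD e he
    rw [noc e he] at hl
    have heX : e ∉ X := fun hx => by
      have : e ∈ E \ {e} := hu ▸ Or.inl hx
      simp at this
    have heY : e ∉ Y := fun hx => by
      have : e ∈ E \ {e} := hu ▸ Or.inr hx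
      simp at this
    have hu1 : insert e X ∪ Y = E := by
      rw [insert_union, hu, insert_sdiff_singleton, insert_eq_of_mem he]
    have hu2 : X ∪ insert e Y = E := by
      rw [union_insert, hu, insert_sdiff_singleton, insert_eq_of_mem he]
    have hd1 : Disjoint (insert e X) Y := by
      rw [disjoint_insert_left]; exact ⟨heY, hd⟩
    have hd2 : Disjoint X (insert e Y) := by
      rw [disjoint_insert_right]; exact ⟨heX, hd⟩
    refine ⟨j, X, Y, h0, h4, hu, hd, hl, hX, hY, ?_, ?_, hu1, hu2, hd1, hd2⟩
    · by_contra hc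
      have := mono (subset_insert e X)
      exact hV j _ _ h0 h4 hu1 hd1 (by omega) (by omega) hY
    · by_contra hc
      have := mono (subset_insert e Y)
      exact hV j _ _ h0 h4 hu2 hd2 (by omega) hX (by omega)
  refine ⟨mono, sub, unit, emp, ?_, ?_, ?_, ?_⟩
  · intro x y hx hy hxy
    have hpos : ∀ z ∈ E, 1 ≤ ρ {z} := by
      intro z hz
      obtain ⟨j, X, Y, -, -, -, -, -, -, -, h1, -⟩ := sepj z hz
      have := sub X {z}
      rw [union_singleton] at this
      omega
    obtain ⟨j, X, Y, -, -, hu, -, -, -, -, h1, h2, -⟩ := sepj x hx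
    have key : ∀ Z, y ∈ Z → ρ Z < ρ (insert x Z) → 2 ≤ ρ {x, y} := by
      intro Z hyZ hlt
      have h3 := sub Z {x, y}
      have h4 : Z ∪ {x, y} = insert x Z := by
        ext w; simp; grind
      have h5 : ρ {y} ≤ ρ (Z ∩ {x, y}) := mono (by simp [hyZ])
      have := hpos y hy
      rw [h4] at h3
      omega
    have hy' : y ∈ X ∪ Y := by rw [hu]; exact ⟨hy, fun h => hxy h.symm⟩
    rcases hy' with hy' | hy'
    · exact key X hy' h1
    · exact key Y hy' h2
  · intro e he
    obtain ⟨j, X, Y, h0, h4, hu, hd, hl, hX, hY, h1, h2, hu1, hu2, hd1, hd2⟩ := sepj e he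
    refine ⟨X, Y, hu, hd, h1, h2, fun hE => ?_⟩
    have u1 := unit e X
    have u2 := unit e Y
    have k1 : j < 3 → ρ Y ≤ j := by
      intro hj
      by_contra hc
      exact hV (j + 1) _ _ (by omega) (by omega) hu1 hd1 (by omega) (by omega) (by omega)
    have k2 : j < 3 → ρ X ≤ j := by
      intro hj
      by_contra hc
      exact hV (j + 1) _ _ (by omega) (by omega) hu2 hd2 (by omega) (by omega) (by omega)
    have h6 := sub (insert e X) Y
    rw [hu1] at h6
    have : ¬ j < 3 := by
      intro hj
      have := k1 hj
      have := k2 hj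
      exact hV j _ _ h0 h4 hu1 hd1 (by omega) (by omega) hY
    omega
  · intro hE X hX h3 h3'
    by_contra hc
    exact hV 3 X (E \ X) (by omega) (by omega) (union_sdiff_cancel hX) disjoint_sdiff_right
      (by omega) h3 h3'
  · intro hE X hX h2
    by_contra hc
    have h1 : ρ (E \ X) ≤ ρ E := mono sdiff_subset
    have h3 := sub X (E \ X)
    rw [union_sdiff_cancel hX] at h3
    exact hV (ρ X) X (E \ X) (by omega) (by omega) (union_sdiff_cancel hX) disjoint_sdiff_right
      (by omega) le_rfl (by omega)

theorem mrk_eq_eRk (M : Matroid α) (X : Set α) : mrk M X = M.eRk X := by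
  apply le_antisymm
  · exact iSup₂_le fun I hI => hI.1.encard_le_eRk_of_subset hI.2
  · obtain ⟨I, hIX, hI, hc⟩ := le_eRk_iff.1 (le_refl (M.eRk X))
    rw [← hc]
    exact le_iSup₂_of_le I ⟨hI, hIX⟩ le_rfl

theorem isVSep_iff_nat (N : Matroid α) (f : Set α → ℕ) (hf : ∀ X ⊆ N.E, N.eRk X = f X)
    {j : ℕ} {X Y : Set α} (h0 : 0 < j) (hu : X ∪ Y = N.E) (hd : Disjoint X Y) :
    IsVSep N j X Y ↔ (f X + f Y < f N.E + j ∧ j ≤ f X ∧ j ≤ f Y) := by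
  have hX : X ⊆ N.E := hu ▸ subset_union_left
  have hY : Y ⊆ N.E := hu ▸ subset_union_right
  have hXY : N.E \ X = Y := by
    rw [← hu, union_sdiff_left, hd.symm.sdiff_eq_left]
  have e : IsVSep N j X Y ↔ (lam N X < (j : ℕ∞) ∧ (j : ℕ∞) ≤ mrk N X ∧ (j : ℕ∞) ≤ mrk N Y) :=
    ⟨fun h => h.2.2, fun h => ⟨hu, hd, h⟩⟩
  rw [e, lam, mrank, hXY]
  simp only [mrk_eq_eRk, hf X hX, hf Y hY, hf N.E subset_rfl]
  norm_cast
  omega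

theorem mcircuit_iff (M : Matroid α) (C : Set α) : MCircuit M C ↔ M.IsCircuit C :=
  isCircuit_iff_forall_ssubset.symm

theorem coctx_of (M : Matroid α) [RankFinite M] (ρ : Set α → ℕ)
    (hρ : ∀ X, (ρ X : ℕ∞) = M.eRk X) (h : VCtx M.E ρ) : VCtx.CoCtx M.E ρ (MCocircuit M) := by
  have hsp : ∀ X ⊆ M.E, (M.Spanning X ↔ ρ M.E ≤ ρ X) := by
    intro X hX
    rw [spanning_iff_eRk_le hX, ← eRk_ground, ← hρ, ← hρ]
    norm_cast
  have hmin : ∀ D, MCocircuit M D → D ⊆ M.E ∧ ¬ (ρ M.E ≤ ρ (M.E \ D)) ∧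
      ∀ e ∈ D, ρ M.E ≤ ρ (insert e (M.E \ D)) := by
    intro D hD
    have hD' : M.IsCocircuit D := (mcircuit_iff _ _).1 hD
    have hDE : D ⊆ M.E := hD'.subset_ground
    have hm := isCocircuit_iff_minimal_compl_nonspanning.1 hD'
    refine ⟨hDE, ?_, ?_⟩
    · rw [← hsp _ sdiff_subset]
      exact hm.prop
    · intro e he
      have h1 : M.E \ (D \ {e}) = insert e (M.E \ D) := by
        ext x
        have := @hDE e he
        simp; grind
      rw [← h1, ← hsp _ sdiff_subset]
      by_contra hc
      have := hm.le_of_le hc sdiff_subset he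
      simp at this
  refine ⟨?_, fun D hD => (hmin D hD).1, ?_, ?_⟩
  · intro X hX hlt
    have h1 : ¬ M.Coindep (M.E \ X) := by
      rw [coindep_iff_compl_spanning sdiff_subset, sdiff_sdiff_cancel_left hX, hsp X hX]
      omega
    rw [coindep_iff_forall_subset_not_isCocircuit] at h1
    have h2 : ∃ K ⊆ M.E \ X, M.IsCocircuit K := by
      by_contra hc
      push Not at hc
      exact h1 ⟨hc, sdiff_subset⟩
    obtain ⟨K, hK, hK'⟩ := h2
    exact ⟨K, (mcircuit_iff _ _).2 hK', fun x hx => (hK hx).2⟩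
  · intro D hD
    obtain ⟨h1, h2, h3⟩ := hmin D hD
    have hne : D.Nonempty := by
      rw [nonempty_iff_ne_empty]
      rintro rfl
      simp at h2
    obtain ⟨e, he⟩ := hne
    have := h3 e he
    have := h.unit e (M.E \ D)
    omega
  · intro D hD e he
    obtain ⟨h1, h2, h3⟩ := hmin D hD
    exact le_antisymm (h.mono (insert_subset (h1 he) sdiff_subset)) (h3 e he)

theorem rankFinite_of_conn (M : Matroid α) (hM : VertConn M 4) (e : α) (he : M.Indep {e}) :
    RankFinite M := by
  rw [← eRank_ne_top_iff]
  intro htop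
  have heE : e ∈ M.E := he.subset_ground rfl
  have hu : {e} ∪ M.E \ {e} = M.E := by
    ext x; by_cases hx : x = e <;> simp [hx, heE]
  have h1 : M.eRk {e} = 1 := by rw [he.eRk_eq_encard]; simp
  have h2 : M.eRk (M.E \ {e}) = ⊤ := by
    have h3 := M.eRk_insert_le_add_one e (M.E \ {e})
    rw [insert_sdiff_singleton, insert_eq_of_mem heE, eRk_ground, htop, top_le_iff] at h3
    simpa using h3
  refine hM 1 {e} (M.E \ {e}) (by omega) (by omega) ⟨hu, by simp, ?_, ?_, ?_⟩
  · simp [lam, mrank, mrk_eq_eRk, htop, h1]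
  · simp [mrk_eq_eRk, h1]
  · simp [mrk_eq_eRk, h2]

theorem tri_of_line {M : Matroid α} {ρ : Set α → ℕ} (hρ : ∀ X, (ρ X : ℕ∞) = M.eRk X)
    (h : VCtx M.E ρ) {L : Set α} (hL : L ⊆ M.E) (h3 : L.ncard = 3) (h2 : ρ L ≤ 2) :
    IsTriangle M L := by
  have hfin : L.Finite := finite_of_ncard_ne_zero (by omega)
  have hc : L.encard = 3 := by rw [← hfin.cast_ncard_eq, h3]; rfl
  refine ⟨(mcircuit_iff _ _).2 ?_, hc⟩
  rw [isCircuit_iff_dep_forall_sdiff_singleton_indep]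
  constructor
  · rw [← eRk_lt_encard_iff_dep_of_finite hfin hL, ← hρ, ← hfin.cast_ncard_eq]
    norm_cast
    omega
  · intro e he
    have hf2 : (L \ {e}).Finite := hfin.sdiff
    have hn : (L \ {e}).ncard = 2 := by
      have := ncard_sdiff_singleton_add_one he hfin
      omega
    rw [indep_iff_eRk_eq_encard_of_finite hf2]
    apply le_antisymm (M.eRk_le_encard _)
    rw [← hρ, ← hf2.cast_ncard_eq, hn]
    exact_mod_cast h.two_of_card (sdiff_subset.trans hL) (by omega)

/-- If `M` is a minimally vertically 4-connected matroid with a triangle `T`, then `M` has a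
4-element cocircuit containing exactly two elements of `T`, or a 5-element cocircuit containing
a triangle and exactly two elements of `T`, or `|E(M)| ≤ 11`. -/
theorem statement_2 (M : Matroid α) (hM : MinVertConn4 M) (T : Set α)
    (hT : IsTriangle M T) :
    (∃ C, MCocircuit M C ∧ C.encard = 4 ∧ (C ∩ T).encard = 2) ∨
    (∃ C, MCocircuit M C ∧ C.encard = 5 ∧ (∃ T' ⊆ C, IsTriangle M T') ∧
      (C ∩ T).encard = 2) ∨
    M.E.encard ≤ 11 := by
  obtain ⟨hcirc, hc3⟩ := hT
  have hTc : M.IsCircuit T := (mcircuit_iff _ _).1 hcirc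
  obtain ⟨a, b, c, hab, hac, hbc, rfl⟩ := encard_eq_three.1 hc3
  have hTE : {a, b, c} ⊆ M.E := hTc.subset_ground
  have hiab : M.Indep {a, b} := hcirc.2 _ (by
    refine ⟨by intro x; simp; grind, fun hs => ?_⟩
    have : c ∈ ({a, b} : Set α) := hs (by simp)
    simp at this
    grind)
  have hia : M.Indep {a} := hiab.subset (by simp)
  have hRF : RankFinite M := rankFinite_of_conn M hM.1 a hia
  have hne : M.eRank ≠ ⊤ := (eRank_ne_top_iff M).2 hRF
  let ρ : Set α → ℕ := fun X => (M.eRk X).toNat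
  have hρ : ∀ X, (ρ X : ℕ∞) = M.eRk X := fun X =>
    ENat.coe_toNat (ne_top_of_le_ne_top hne (M.eRk_le_eRank X))
  clear_value ρ
  have mono : ∀ {X Y : Set α}, X ⊆ Y → ρ X ≤ ρ Y := by
    intro X Y hXY
    have := M.eRk_mono hXY
    rw [← hρ, ← hρ] at this
    exact_mod_cast this
  have hEE : 2 ≤ ρ M.E := by
    have h1 : (ρ {a, b} : ℕ∞) = 2 := by
      rw [hρ, hiab.eRk_eq_encard, encard_pair hab]
    have h1' : ρ {a, b} = 2 := by exact_mod_cast h1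
    rw [← h1']
    exact mono hiab.subset_ground
  have h : VCtx M.E ρ := by
    refine VCtx.mk_of mono ?_ ?_ ?_ hEE ?_ ?_
    · intro X Y
      have := M.eRk_inter_add_eRk_union_le X Y
      simp only [← hρ] at this
      rw [add_comm]
      exact_mod_cast this
    · intro e X
      have := M.eRk_insert_le_add_one e X
      simp only [← hρ] at this
      exact_mod_cast this
    · have h1 : (ρ ∅ : ℕ∞) = 0 := by rw [hρ]; simp
      exact_mod_cast h1
    · intro j X Y h0 h4 hu hd hl hX hY
      exact hM.1 j X Y h0 h4
        ((isVSep_iff_nat M ρ (fun X _ => (hρ X).symm) h0 hu hd).2 ⟨hl, hX, hY⟩)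
    · intro e he
      have h1 := hM.2 e he
      unfold VertConn at h1
      push Not at h1
      obtain ⟨j, X, Y, h0, h4, hs⟩ := h1
      have hu : X ∪ Y = M.E \ {e} := hs.1
      refine ⟨j, X, Y, h0, h4, hu, hs.2.1, ?_⟩
      exact (isVSep_iff_nat (mdel M {e}) ρ
        (fun Z hZ => by rw [hρ]; exact M.restrict_eRk_eq hZ) h0 hs.1 hs.2.1).1 hs
  have co := coctx_of M ρ hρ h
  have hrT : ρ {a, b, c} ≤ 2 := by
    have h1 := hTc.eRk_add_one_eq
    rw [hc3, ← hρ] at h1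
    have h2 : ρ {a, b, c} + 1 = 3 := by exact_mod_cast h1
    omega
  have t : VCtx.Tri M.E ρ a b c :=
    { ha := hTE (by simp), hb := hTE (by simp), hc := hTE (by simp), hab := hab, hac := hac,
      hbc := hbc, hr := hrT }
  rcases VCtx.main h co t with ⟨D, hD, hDf, hDT, hD45⟩ | ⟨hEf, hE11⟩
  · have hDT' : (D ∩ {a, b, c}).encard = 2 := by
      rw [← (hDf.inter_of_left _).cast_ncard_eq, hDT]; rfl
    rcases hD45 with h4 | ⟨h5, L, hLD, hL3, hL2⟩
    · left
      refine ⟨D, hD, ?_, hDT'⟩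
      rw [← hDf.cast_ncard_eq, h4]; rfl
    · right; left
      refine ⟨D, hD, ?_, ⟨L, hLD, tri_of_line hρ h (hLD.trans (co.sub D hD)) hL3 hL2⟩, hDT'⟩
      rw [← hDf.cast_ncard_eq, h5]; rfl
  · right; right
    rw [← hEf.cast_ncard_eq]
    exact_mod_cast hE11
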